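/- arXiv:1505.06433 — 3 statements merged into one kernel-verified Lean document; each statement's English description precedes it below -/
import Mathlib

section
/- Let Q be a prequantale, and define residuals by x / y := sSup {z | z * y ≤ x} and y \ x := sSup {z | y * z ≤ x}. Let C be a subset of Q closed under arbitrary infima (sInf T ∈ C for every T ⊆ C; in particular ⊤ ∈ C), and let ⋆_C be the closure operation defined by ⋆_C(x) = ⨅ { a ∈ C | x ≤ a }. Then ⋆_C is a nucleus on Q if and only if for every x ∈ C and every y ∈ Q one has x / y ∈ C and y \ x ∈ C. -/
/-- A closure operation on a poset: expansive, monotone, idempotent. -/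
def IsClosureOp {S : Type*} [Preorder S] (star : S → S) : Prop :=
  (∀ x, x ≤ star x) ∧ (∀ x y, x ≤ y → star x ≤ star y) ∧ (∀ x, star (star x) = star x)

/-- A nucleus on an ordered magma: a closure operation `star` with
`star x * star y ≤ star (x * y)`. -/
def IsNucleusOp {M : Type*} [Preorder M] [Mul M] (star : M → M) : Prop :=
  IsClosureOp star ∧ ∀ x y, star x * star y ≤ star (x * y)

theorem mul_mono_right_of_mul_sSup {Q : Type*} [CompleteLattice Q] [Mul Q]
    (hl : ∀ (a : Q) (S : Set Q), a * sSup S = ⨆ s ∈ S, a * s)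
    (a : Q) {b c : Q} (h : b ≤ c) : a * b ≤ a * c := by
  have key := hl a {b, c}
  rw [sSup_pair, sup_eq_right.2 h] at key
  rw [key]
  exact le_iSup₂_of_le b (Set.mem_insert _ _) le_rfl

theorem mul_mono_left_of_sSup_mul {Q : Type*} [CompleteLattice Q] [Mul Q]
    (hr : ∀ (a : Q) (S : Set Q), sSup S * a = ⨆ s ∈ S, s * a)
    (a : Q) {b c : Q} (h : b ≤ c) : b * a ≤ c * a := by
  have key := hr a {b, c}
  rw [sSup_pair, sup_eq_right.2 h] at key
  rw [key]
  exact le_iSup₂_of_le b (Set.mem_insert _ _) le_rfl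

/-- The adjunction between right multiplication by `y` and the residual `x / y`. -/
theorem le_sSup_mul_le_iff {Q : Type*} [CompleteLattice Q] [Mul Q]
    (hr : ∀ (a : Q) (S : Set Q), sSup S * a = ⨆ s ∈ S, s * a) (w x y : Q) :
    w ≤ sSup {z | z * y ≤ x} ↔ w * y ≤ x := by
  refine ⟨fun h => (mul_mono_left_of_sSup_mul hr y h).trans ?_, fun h => le_sSup h⟩
  rw [hr]
  exact iSup₂_le fun _ hz => hz

/-- The adjunction between left multiplication by `y` and the residual of `x` by `y`. -/
theorem le_sSup_le_mul_iff {Q : Type*} [CompleteLattice Q] [Mul Q]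
    (hl : ∀ (a : Q) (S : Set Q), a * sSup S = ⨆ s ∈ S, a * s) (w x y : Q) :
    w ≤ sSup {z | y * z ≤ x} ↔ y * w ≤ x := by
  refine ⟨fun h => (mul_mono_right_of_mul_sSup hl y h).trans ?_, fun h => le_sSup h⟩
  rw [hl]
  exact iSup₂_le fun _ hz => hz

theorem stmt10 (Q : Type*) [CompleteLattice Q] [Mul Q]
    (hl : ∀ (a : Q) (S : Set Q), a * sSup S = ⨆ s ∈ S, a * s)
    (hr : ∀ (a : Q) (S : Set Q), sSup S * a = ⨆ s ∈ S, s * a)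
    (C : Set Q) (hC : ∀ T ⊆ C, sInf T ∈ C)
    (starC : Q → Q) (hdef : ∀ x, starC x = sInf {a | a ∈ C ∧ x ≤ a}) :
    IsNucleusOp starC ↔
      ∀ x ∈ C, ∀ y : Q, sSup {z | z * y ≤ x} ∈ C ∧ sSup {z | y * z ≤ x} ∈ C := by
  have mem : ∀ x, starC x ∈ C := fun x => hdef x ▸ hC _ fun _ ha => ha.1
  have expand : ∀ x, x ≤ starC x := fun x => hdef x ▸ le_sInf fun _ ha => ha.2
  have least : ∀ {x c}, c ∈ C → x ≤ c → starC x ≤ c := fun {x c} hc hx =>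
    hdef x ▸ sInf_le ⟨hc, hx⟩
  have mem_of_le : ∀ {x}, starC x ≤ x → x ∈ C := fun {x} h => le_antisymm h (expand x) ▸ mem x
  constructor
  · rintro ⟨-, hmul⟩ x hx y
    constructor
    · apply mem_of_le
      rw [le_sSup_mul_le_iff hr]
      exact (mul_mono_right_of_mul_sSup hl _ (expand y)).trans <|
        (hmul _ _).trans <| least hx <| (le_sSup_mul_le_iff hr _ _ _).1 le_rfl
    · apply mem_of_le
      rw [le_sSup_le_mul_iff hl]
      exact (mul_mono_left_of_sSup_mul hr _ (expand y)).trans <|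
        (hmul _ _).trans <| least hx <| (le_sSup_le_mul_iff hl _ _ _).1 le_rfl
  · intro h
    refine ⟨⟨expand, fun x y hxy => least (mem y) (hxy.trans (expand y)),
      fun x => le_antisymm (least (mem x) le_rfl) (expand _)⟩, fun x y => ?_⟩
    have hx : starC x * y ≤ starC (x * y) :=
      (le_sSup_mul_le_iff hr _ _ _).1 <|
        least (h _ (mem _) y).1 ((le_sSup_mul_le_iff hr _ _ _).2 (expand _))
    exact (le_sSup_le_mul_iff hl _ _ _).1 <|
      least (h _ (mem _) _).2 ((le_sSup_le_mul_iff hl _ _ _).2 hx)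
end

section
/- Let S be an algebraic complete lattice, i.e., every element of S is the supremum of the compact elements below it. Let ⋆ be a closure operation on S and define ⋆_f(x) = ⨆ { ⋆y | y compact and y ≤ x }. Then ⋆_f is a closure operation on S, ⋆_f(x) ≤ ⋆(x) for all x, ⋆_f(y) = ⋆(y) for every compact y, ⋆_f is finitary, and ⋆_f is the largest finitary closure operation on S that is pointwise smaller than ⋆. -/
open CompleteLattice

/-- A closure operation is finitary if it commutes with suprema of nonempty
directed sets. -/
def FinitaryOp {S : Type*} [CompleteLattice S] (star : S → S) : Prop :=
  ∀ Δ : Set S, Δ.Nonempty → DirectedOn (· ≤ ·) Δ → star (sSup Δ) = ⨆ d ∈ Δ, star d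

theorem directedOn_isCompactElement_le {S : Type*} [CompleteLattice S] (x : S) :
    DirectedOn (· ≤ ·) {c | IsCompactElement c ∧ c ≤ x} := by
  classical
  rintro a ⟨ha, hax⟩ b ⟨hb, hbx⟩
  refine ⟨a ⊔ b, ⟨?_, sup_le hax hbx⟩, le_sup_left, le_sup_right⟩
  simpa using isCompactElement_finsetSup (f := id) ({a, b} : Finset S) (by simp [ha, hb])

theorem nonempty_isCompactElement_le {S : Type*} [CompleteLattice S] (x : S) :
    {c | IsCompactElement c ∧ c ≤ x}.Nonempty :=
  ⟨⊥, by simpa using isCompactElement_finsetSup (f := id) (∅ : Finset S) (by simp), bot_le⟩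

theorem stmt15 (S : Type*) [CompleteLattice S]
    (halg : ∀ x : S, x = sSup {c | IsCompactElement c ∧ c ≤ x})
    (star : S → S) (hstar : IsClosureOp star)
    (starf : S → S)
    (hdef : ∀ x, starf x = sSup (star '' {y | IsCompactElement y ∧ y ≤ x})) :
    IsClosureOp starf ∧ (∀ x, starf x ≤ star x) ∧
      (∀ y : S, IsCompactElement y → starf y = star y) ∧
      FinitaryOp starf ∧
      ∀ σ : S → S, IsClosureOp σ → FinitaryOp σ → (∀ x, σ x ≤ star x) →
        ∀ x, σ x ≤ starf x := by
  obtain ⟨hexp, hmono, hidem⟩ := hstar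
  have le_starf {y x : S} (hy : IsCompactElement y) (hyx : y ≤ x) : star y ≤ starf x :=
    (hdef x).symm ▸ le_sSup ⟨y, ⟨hy, hyx⟩, rfl⟩
  have starf_le {x z : S} (h : ∀ y, IsCompactElement y → y ≤ x → star y ≤ z) : starf x ≤ z := by
    rw [hdef]
    refine sSup_le ?_
    rintro _ ⟨y, ⟨hy, hyx⟩, rfl⟩
    exact h y hy hyx
  have starf_mono (x y : S) (hxy : x ≤ y) : starf x ≤ starf y :=
    starf_le fun c hc hcx => le_starf hc (hcx.trans hxy)
  have le_self (x : S) : x ≤ starf x :=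
    (halg x).le.trans (sSup_le fun c hc => (hexp c).trans (le_starf hc.1 hc.2))
  have starf_le_star (x : S) : starf x ≤ star x := starf_le fun y _ hyx => hmono y x hyx
  refine ⟨⟨le_self, starf_mono, fun x => le_antisymm (starf_le fun z hz hzx => ?_) (le_self _)⟩,
    starf_le_star, fun y hy => le_antisymm (starf_le_star y) (le_starf hy le_rfl),
    fun Δ hne hdir => le_antisymm (starf_le fun y hy hyΔ => ?_)
      (iSup₂_le fun d hd => starf_mono _ _ (le_sSup hd)),
    fun σ _ hfin hle x => ?_⟩
  · rw [hdef] at hzx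
    have hdir : DirectedOn (· ≤ ·) (star '' {y | IsCompactElement y ∧ y ≤ x}) := by
      rintro _ ⟨a, ha, rfl⟩ _ ⟨b, hb, rfl⟩
      obtain ⟨c, hc, hac, hbc⟩ := directedOn_isCompactElement_le x a ha b hb
      exact ⟨star c, ⟨c, hc, rfl⟩, hmono _ _ hac, hmono _ _ hbc⟩
    obtain ⟨_, ⟨y, ⟨hy, hyx⟩, rfl⟩, hzy⟩ :=
      hz _ _ ((nonempty_isCompactElement_le x).image star) hdir (_root_.isLUB_sSup _) hzx
    calc star z ≤ star (star y) := hmono _ _ hzy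
      _ = star y := hidem y
      _ ≤ starf x := le_starf hy hyx
  · obtain ⟨d, hd, hyd⟩ := hy Δ _ hne hdir (_root_.isLUB_sSup Δ) hyΔ
    exact (le_starf hy hyd).trans (le_iSup₂ (f := fun d _ => starf d) d hd)
  · calc σ x = σ (sSup {c | IsCompactElement c ∧ c ≤ x}) := congrArg σ (halg x)
      _ = ⨆ c ∈ {c | IsCompactElement c ∧ c ≤ x}, σ c :=
        hfin _ (nonempty_isCompactElement_le x) (directedOn_isCompactElement_le x)
      _ ≤ starf x := iSup₂_le fun c hc => (hle c).trans (le_starf hc.1 hc.2)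
end

section
/- Let Q be a precoherent multiplicative lattice: a commutative monoid with a complete lattice structure satisfying a * sSup S = ⨆_{s ∈ S} (a * s), in which every element is the supremum of the compact elements below it and the product of two compact elements is compact. Define x / y := sSup {z | z * y ≤ x}. Call a nucleus σ on Q stable if σ(x ⊓ y) = σ(x) ⊓ σ(y) for all x, y and σ(x / t) = σ(x) / t for every x and every compact t. Let ⋆ be a nucleus on Q and define ⋆̄(x) = ⨆ { x / z | z ≤ 1 and ⋆(z) = ⋆(1) }. Then ⋆̄ is the largest stable nucleus on Q pointwise smaller than ⋆: ⋆̄ is a stable nucleus with ⋆̄ ≤ ⋆ pointwise, and every stable nucleus σ ≤ ⋆ satisfies σ ≤ ⋆̄. Moreover, the following are equivalent: (1) ⋆ is stable; (2) ⋆(x ⊓ 1) = ⋆(x) ⊓ ⋆(1) and ⋆(x / t) = ⋆(x) / t for all x and all compact t; (3) ⋆((x / t) ⊓ 1) = (⋆(x) / t) ⊓ ⋆(1) for all x and all compact t; (4) ⋆ = ⋆̄. -/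
open CompleteLattice

/-- A self-map `σ` is stable (with respect to the residual operation `div`) if
it distributes over binary infima and satisfies `σ (x / t) = σ x / t` for all
compact `t`. -/
def IsStableOp {Q : Type*} [CompleteLattice Q] (div : Q → Q → Q) (σ : Q → Q) : Prop :=
  (∀ x y, σ (x ⊓ y) = σ x ⊓ σ y) ∧
    ∀ x t, IsCompactElement t → σ (div x t) = div (σ x) t

section Residuation

variable {Q : Type*} [CommMonoid Q] [CompleteLattice Q]

theorem mul_le_mul_of_mul_sSup (hl : ∀ (a : Q) (S : Set Q), a * sSup S = ⨆ s ∈ S, a * s)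
    {a b c d : Q} (hab : a ≤ b) (hcd : c ≤ d) : a * c ≤ b * d := by
  have key : ∀ {x y : Q} (z : Q), x ≤ y → z * x ≤ z * y := by
    intro x y z h
    have hy : y = sSup {x, y} := by rw [sSup_pair, sup_eq_right.2 h]
    rw [hy, hl]
    exact le_iSup₂_of_le x (by simp) le_rfl
  calc a * c ≤ a * d := key a hcd
    _ = d * a := mul_comm _ _
    _ ≤ d * b := key d hab
    _ = b * d := mul_comm _ _

theorem le_div_iff_of_mul_sSup (hl : ∀ (a : Q) (S : Set Q), a * sSup S = ⨆ s ∈ S, a * s)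
    {div : Q → Q → Q} (hdiv : ∀ x y, div x y = sSup {z | z * y ≤ x}) {x y z : Q} :
    z ≤ div x y ↔ z * y ≤ x := by
  rw [hdiv]
  refine ⟨fun h => ?_, fun h => le_sSup h⟩
  refine (mul_le_mul_of_mul_sSup hl h le_rfl).trans ?_
  rw [mul_comm, hl]
  exact iSup₂_le fun s hs => (mul_comm y s).trans_le hs

theorem le_of_forall_isCompactElement_le {P : Type*} [CompleteLattice P]
    (halg : ∀ x : P, x = sSup {c | IsCompactElement c ∧ c ≤ x})
    {x y : P} (h : ∀ c, IsCompactElement c → c ≤ x → c ≤ y) : x ≤ y := by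
  rw [halg x]
  exact sSup_le fun c hc => h c hc.1 hc.2

/-- For a nucleus `star`, the elements `z ≤ 1` with `star z = star 1` are closed under products. -/
theorem IsNucleusOp.map_mul_eq_map_one {star : Q → Q} (hstar : IsNucleusOp star)
    (hl : ∀ (a : Q) (S : Set Q), a * sSup S = ⨆ s ∈ S, a * s)
    {z w : Q} (hz : z ≤ 1 ∧ star z = star 1) (hw : w ≤ 1 ∧ star w = star 1) :
    z * w ≤ 1 ∧ star (z * w) = star 1 := by
  obtain ⟨⟨hexp, hmono, hidem⟩, hmul⟩ := hstar
  have h1 : z * w ≤ 1 := (mul_le_mul_of_mul_sSup hl hz.1 hw.1).trans_eq (one_mul 1)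
  refine ⟨h1, le_antisymm (hmono _ _ h1) ?_⟩
  rw [← hidem (z * w)]
  refine hmono _ _ (le_trans ?_ (hmul z w))
  rw [hz.2, hw.2]
  exact (one_mul 1).symm.trans_le (mul_le_mul_of_mul_sSup hl (hexp 1) (hexp 1))

/-- A compact element lies below the directed supremum of the residuals `div x z` over
`z ≤ 1`, `star z = star 1` iff it lies below one of them. -/
theorem IsNucleusOp.isCompactElement_le_sSup_div_iff {star : Q → Q} (hstar : IsNucleusOp star)
    (hl : ∀ (a : Q) (S : Set Q), a * sSup S = ⨆ s ∈ S, a * s)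
    {div : Q → Q → Q} (hdiv : ∀ x y, div x y = sSup {z | z * y ≤ x})
    {c : Q} (hc : IsCompactElement c) {x : Q} :
    c ≤ sSup (div x '' {z | z ≤ 1 ∧ star z = star 1}) ↔
      ∃ z, (z ≤ 1 ∧ star z = star 1) ∧ c * z ≤ x := by
  have hres := @le_div_iff_of_mul_sSup Q _ _ hl div hdiv
  have hle : ∀ {u v : Q}, v ≤ u → div x u ≤ div x v := fun {u v} h =>
    hres.2 ((mul_le_mul_of_mul_sSup hl le_rfl h).trans (hres.1 le_rfl))
  constructor
  · intro h
    have hne : (div x '' {z | z ≤ 1 ∧ star z = star 1}).Nonempty :=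
      ⟨_, 1, ⟨le_rfl, rfl⟩, rfl⟩
    have hdir : DirectedOn (· ≤ ·) (div x '' {z | z ≤ 1 ∧ star z = star 1}) := by
      rintro _ ⟨z, hz, rfl⟩ _ ⟨w, hw, rfl⟩
      refine ⟨_, ⟨z * w, hstar.map_mul_eq_map_one hl hz hw, rfl⟩, hle ?_, hle ?_⟩
      · exact (mul_le_mul_of_mul_sSup hl le_rfl hw.1).trans_eq (mul_one z)
      · exact (mul_le_mul_of_mul_sSup hl hz.1 le_rfl).trans_eq (one_mul w)
    obtain ⟨_, ⟨z, hz, rfl⟩, hcz⟩ := hc _ _ hne hdir (_root_.isLUB_sSup _) h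
    exact ⟨z, hz, hres.1 hcz⟩
  · rintro ⟨z, hz, hcz⟩
    exact (hres.2 hcz).trans (le_sSup ⟨z, hz, rfl⟩)

end Residuation

theorem stmt16 (Q : Type*) [CommMonoid Q] [CompleteLattice Q]
    (hl : ∀ (a : Q) (S : Set Q), a * sSup S = ⨆ s ∈ S, a * s)
    (halg : ∀ x : Q, x = sSup {c | IsCompactElement c ∧ c ≤ x})
    (hcomp : ∀ x y : Q, IsCompactElement x → IsCompactElement y →
      IsCompactElement (x * y))
    (div : Q → Q → Q) (hdiv : ∀ x y, div x y = sSup {z | z * y ≤ x})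
    (star : Q → Q) (hstar : IsNucleusOp star)
    (bar : Q → Q)
    (hbar : ∀ x, bar x = sSup (div x '' {z | z ≤ 1 ∧ star z = star 1})) :
    (IsNucleusOp bar ∧ IsStableOp div bar ∧ (∀ x, bar x ≤ star x) ∧
      ∀ σ : Q → Q, IsNucleusOp σ → IsStableOp div σ → (∀ x, σ x ≤ star x) →
        ∀ x, σ x ≤ bar x) ∧
    List.TFAE
      [ IsStableOp div star,
        (∀ x : Q, star (x ⊓ 1) = star x ⊓ star 1) ∧
          ∀ x t : Q, IsCompactElement t → star (div x t) = div (star x) t,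
        ∀ x t : Q, IsCompactElement t →
          star (div x t ⊓ 1) = div (star x) t ⊓ star 1,
        star = bar ] := by
  have hres := @le_div_iff_of_mul_sSup Q _ _ hl div hdiv
  have mul_mono : ∀ {a b c d : Q}, a ≤ b → c ≤ d → a * c ≤ b * d :=
    mul_le_mul_of_mul_sSup hl
  have ext_le : ∀ {x y : Q}, (∀ c, IsCompactElement c → c ≤ x → c ≤ y) → x ≤ y :=
    le_of_forall_isCompactElement_le halg
  have hprod := @IsNucleusOp.map_mul_eq_map_one Q _ _ star hstar hl
  have hbar_iff : ∀ {c x : Q}, IsCompactElement c →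
      (c ≤ bar x ↔ ∃ z, (z ≤ 1 ∧ star z = star 1) ∧ c * z ≤ x) := by
    intro c x hc
    rw [hbar]
    exact hstar.isCompactElement_le_sSup_div_iff hl hdiv hc
  obtain ⟨⟨hexp, hmono, hidem⟩, hmul⟩ := hstar
  have hbar_iff' : ∀ {c x : Q}, IsCompactElement c →
      (c ≤ bar x ↔ 1 ≤ star (div x c ⊓ 1)) := by
    intro c x hc
    rw [hbar_iff hc]
    constructor
    · rintro ⟨z, hz, hcz⟩
      refine (hexp 1).trans (hz.2.symm.trans_le (hmono _ _ (le_inf (hres.2 ?_) hz.1)))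
      rwa [mul_comm]
    · intro h
      refine ⟨div x c ⊓ 1, ⟨inf_le_right, le_antisymm (hmono _ _ inf_le_right) ?_⟩, ?_⟩
      · exact (hmono _ _ h).trans_eq (hidem _)
      · rw [mul_comm]
        exact hres.1 inf_le_left
  have bar_exp : ∀ x, x ≤ bar x := fun x => ext_le fun c hc hcx =>
    (hbar_iff hc).2 ⟨1, ⟨le_rfl, rfl⟩, by rwa [mul_one]⟩
  have bar_mono : ∀ x y, x ≤ y → bar x ≤ bar y := fun x y hxy => ext_le fun c hc hcx => by
    obtain ⟨z, hz, hcz⟩ := (hbar_iff hc).1 hcx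
    exact (hbar_iff hc).2 ⟨z, hz, hcz.trans hxy⟩
  have bar_idem : ∀ x, bar (bar x) = bar x := by
    refine fun x => le_antisymm (ext_le fun c hc hcx => ?_) (bar_exp _)
    have hle : div (bar x) c ⊓ 1 ≤ star (div x c ⊓ 1) := by
      refine ext_le fun d hd hdx => ?_
      have h1 := (hbar_iff' (hcomp d c hd hc)).1 (hres.1 (hdx.trans inf_le_left))
      calc d = d * 1 := (mul_one d).symm
        _ ≤ star d * star (div x (d * c) ⊓ 1) := mul_mono (hexp d) h1
        _ ≤ star (d * (div x (d * c) ⊓ 1)) := hmul _ _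
        _ ≤ star (div x c ⊓ 1) := hmono _ _ (le_inf (hres.2 ?_) ?_)
      · calc d * (div x (d * c) ⊓ 1) * c = (div x (d * c) ⊓ 1) * (d * c) := by
              rw [mul_comm d, mul_assoc]
          _ ≤ x := hres.1 inf_le_left
      · exact (mul_mono (hdx.trans inf_le_right) inf_le_right).trans_eq (one_mul 1)
    exact (hbar_iff' hc).2
      (((hbar_iff' hc).1 hcx).trans ((hmono _ _ hle).trans_eq (hidem _)))
  have bar_mul : ∀ x y, bar x * bar y ≤ bar (x * y) := by
    intro x y
    have hx : bar x ≤ div (bar (x * y)) (bar y) := by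
      refine ext_le fun c hc hcx => ?_
      rw [hres, mul_comm, ← hres]
      refine ext_le fun d hd hdy => hres.2 ?_
      rw [mul_comm]
      obtain ⟨z, hz, hcz⟩ := (hbar_iff hc).1 hcx
      obtain ⟨w, hw, hdw⟩ := (hbar_iff hd).1 hdy
      refine (hbar_iff (hcomp c d hc hd)).2 ⟨z * w, hprod hz hw, ?_⟩
      rw [mul_mul_mul_comm]
      exact mul_mono hcz hdw
    exact hres.1 hx
  have bar_inf : ∀ x y, bar (x ⊓ y) = bar x ⊓ bar y := by
    refine fun x y => le_antisymm
      (le_inf (bar_mono _ _ inf_le_left) (bar_mono _ _ inf_le_right)) (ext_le fun c hc hcx => ?_)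
    obtain ⟨z, hz, hcz⟩ := (hbar_iff hc).1 (hcx.trans inf_le_left)
    obtain ⟨w, hw, hcw⟩ := (hbar_iff hc).1 (hcx.trans inf_le_right)
    refine (hbar_iff hc).2 ⟨z * w, hprod hz hw, le_inf ?_ ?_⟩
    · exact (mul_mono le_rfl
        ((mul_mono le_rfl hw.1).trans_eq (mul_one z))).trans hcz
    · exact (mul_mono le_rfl
        ((mul_mono hz.1 le_rfl).trans_eq (one_mul w))).trans hcw
  have bar_div : ∀ x t, IsCompactElement t → bar (div x t) = div (bar x) t := by
    intro x t ht
    have h : ∀ c, IsCompactElement c → (c ≤ bar (div x t) ↔ c ≤ div (bar x) t) := by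
      intro c hc
      simp only [hbar_iff hc, hres, hbar_iff (hcomp c t hc ht), mul_right_comm]
    exact le_antisymm (ext_le fun c hc => (h c hc).1) (ext_le fun c hc => (h c hc).2)
  have bar_le : ∀ x, bar x ≤ star x := fun x => ext_le fun c hc hcx => by
    obtain ⟨z, hz, hcz⟩ := (hbar_iff hc).1 hcx
    calc c = c * 1 := (mul_one c).symm
      _ ≤ star c * star z := mul_mono (hexp c) ((hexp 1).trans_eq hz.2.symm)
      _ ≤ star (c * z) := hmul _ _
      _ ≤ star x := hmono _ _ hcz
  have bar_stable : IsStableOp div bar := ⟨bar_inf, bar_div⟩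
  refine ⟨⟨⟨⟨bar_exp, bar_mono, bar_idem⟩, bar_mul⟩, bar_stable, bar_le, ?_⟩, ?_⟩
  · rintro σ ⟨⟨σ_exp, -, -⟩, -⟩ ⟨σ_inf, σ_div⟩ hσ x
    refine ext_le fun c hc hcx => (hbar_iff' hc).2 (le_trans ?_ (hσ _))
    rw [σ_inf, σ_div x c hc]
    exact le_inf (hres.2 (by rwa [one_mul])) (σ_exp 1)
  · tfae_have 1 → 2 := fun h => ⟨fun x => h.1 x 1, h.2⟩
    tfae_have 2 → 3 := fun h x t ht => by rw [h.1, h.2 x t ht]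
    tfae_have 3 → 4 := fun h => by
      refine funext fun x => le_antisymm (ext_le fun c hc hcx => (hbar_iff' hc).2 ?_) (bar_le x)
      rw [h x c hc]
      exact le_inf (hres.2 (by rwa [one_mul])) (hexp 1)
    tfae_have 4 → 1 := fun h => h ▸ bar_stable
    tfae_finish
end
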